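/- Let p : ℝ → [0,∞) be a differentiable probability density with respect to Lebesgue measure satisfying |p'(z)| ≤ R for all z ∈ ℝ, where R < ∞. Then for every h > 0, ∫_{ℝ} (p(z+h) − p(z))² dz ≤ 2·R·h. -/

import Mathlib

open MeasureTheory Real

theorem stmt12
    -- p is a differentiable probability density with |p'| ≤ R
    (p : ℝ → ℝ) (hp_nonneg : ∀ z, 0 ≤ p z)
    (hp_prob : ∫ z, p z = 1)
    (hp_int : Integrable p)
    (hp_diff : Differentiable ℝ p)
    (R : ℝ) (hR : ∀ z, |deriv p z| ≤ R) :
    -- STATEMENT: the L² modulus of continuity bound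
    ∀ h : ℝ, 0 < h → ∫ z, (p (z + h) - p z) ^ 2 ≤ 2 * R * h := by
  intro h hh
  have hlip : ∀ z, |p (z + h) - p z| ≤ R * h := by
    intro z
    have := Convex.norm_image_sub_le_of_norm_deriv_le (f := p) (C := R) (s := Set.univ)
      (x := z) (y := z + h) (fun x _ => hp_diff x)
      (fun x _ => by simpa [Real.norm_eq_abs] using hR x) convex_univ (Set.mem_univ _)
      (Set.mem_univ _)
    simpa [Real.norm_eq_abs, abs_of_pos hh] using this
  have hint : Integrable (fun z => p (z + h)) := hp_int.comp_add_right h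
  have hshift : ∫ z, p (z + h) = 1 := by
    rw [integral_add_right_eq_self (μ := volume) p h, hp_prob]
  calc ∫ z, (p (z + h) - p z) ^ 2 ≤ ∫ z, (R * h) * (p (z + h) + p z) := by
        apply integral_mono_of_nonneg
        · exact Filter.Eventually.of_forall fun z => sq_nonneg _
        · exact (hint.add hp_int).const_mul _
        · refine Filter.Eventually.of_forall fun z => ?_
          have h1 := hlip z
          have h2 : |p (z + h) - p z| ≤ p (z + h) + p z := by
            rw [abs_le]
            constructor <;> linarith [hp_nonneg z, hp_nonneg (z + h)]
          have h3 := mul_le_mul h1 h2 (abs_nonneg _) ((abs_nonneg _).trans h1)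
          rw [abs_mul_abs_self] at h3
          simpa [sq] using h3
    _ = 2 * R * h := by
        rw [integral_const_mul, integral_add hint hp_int, hshift, hp_prob]
        ring
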